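/- arXiv:1104.5439 — 4 statements merged into one kernel-verified Lean document; each statement's English description precedes it below -/
import Mathlib

section
/- Let f : ℝ → ℂ^N be continuous with compact support and define φ(x) = −U(x) P₊ ∫_{x}^{∞} U(y)⁻¹ f(y) dy + U(x) P₋ ∫_{−∞}^{x} U(y)⁻¹ f(y) dy. Then φ is continuous, satisfies φ(x) = φ(x₀) + ∫_{x₀}^{x} ((L₀ + V(y)) φ(y) + f(y)) dy for all x₀, x (i.e. φ solves φ' = (L₀ + V(x))φ + f in the integrated sense), and φ(x) = O(e^{−ρ₊|x|}) as x → −∞ and φ(x) = O(e^{−ρ₋|x|}) as x → +∞. -/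
open MeasureTheory Filter Topology Asymptotics

noncomputable section

/-- A (continuous, integrated-sense) solution of the first order system `u' = L(x) u`. -/
def IsSolV (N : ℕ) (L : ℝ → Matrix (Fin N) (Fin N) ℂ) (u : ℝ → Fin N → ℂ) : Prop :=
  Continuous u ∧ ∀ x₀ x : ℝ, u x = u x₀ + ∫ y in x₀..x, (L y).mulVec (u y)

/-- Fubini's theorem on the triangle `a ≤ y ≤ x ≤ b`. -/
lemma integral_primitive_mul_eq {h g : ℝ → ℂ} {a b : ℝ} (hab : a ≤ b)
    (hh : IntervalIntegrable h volume a b) (hg : IntervalIntegrable g volume a b) :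
    ∫ x in a..b, (∫ y in a..x, h y) * g x = ∫ y in a..b, h y * ∫ x in y..b, g x := by
  rw [intervalIntegrable_iff_integrableOn_Ioc_of_le hab] at hh hg
  have hint : Integrable (Function.uncurry fun x y : ℝ =>
      {q : ℝ × ℝ | q.2 ≤ q.1}.indicator (fun q => g q.1 * h q.2) (x, y))
      ((volume.restrict (Set.Ioc a b)).prod (volume.restrict (Set.Ioc a b))) :=
    (hg.mul_prod hh).indicator (measurableSet_le measurable_snd measurable_fst)
  have hswap := integral_integral_swap hint
  rw [intervalIntegral.integral_of_le hab, intervalIntegral.integral_of_le hab]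
  refine Eq.trans (setIntegral_congr_fun measurableSet_Ioc fun x hx => ?_)
    (hswap.trans (setIntegral_congr_fun measurableSet_Ioc fun y hy => ?_))
  · have hind : ∀ y : ℝ, {q : ℝ × ℝ | q.2 ≤ q.1}.indicator (fun q => g q.1 * h q.2) (x, y)
        = (Set.Iic x).indicator (fun y => g x * h y) y := fun y => rfl
    simp only [hind]
    rw [setIntegral_indicator measurableSet_Iic, Set.Ioc_inter_Iic, min_eq_right hx.2,
      integral_const_mul, intervalIntegral.integral_of_le hx.1.le, mul_comm]
  · have hind : ∀ x : ℝ, {q : ℝ × ℝ | q.2 ≤ q.1}.indicator (fun q => g q.1 * h q.2) (x, y)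
        = (Set.Ici y).indicator (fun x => g x * h y) x := fun x => rfl
    have hset : Set.Ioc a b ∩ Set.Ici y = Set.Icc y b := by
      ext x
      simp only [Set.mem_inter_iff, Set.mem_Ioc, Set.mem_Ici, Set.mem_Icc]
      exact ⟨fun h => ⟨h.2, h.1.2⟩, fun h => ⟨⟨hy.1.trans_le h.1, h.2⟩, h.1⟩⟩
    simp only [hind]
    rw [setIntegral_indicator measurableSet_Ici, hset, integral_mul_const,
      integral_Icc_eq_integral_Ioc, intervalIntegral.integral_of_le hy.2, mul_comm]

lemma continuous_of_eq_add_integral {w h : ℝ → ℂ} (hh : ∀ a b, IntervalIntegrable h volume a b)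
    (hw : ∀ x₀ x, w x = w x₀ + ∫ y in x₀..x, h y) : Continuous w := by
  rw [show w = fun x => w 0 + ∫ y in (0 : ℝ)..x, h y from funext (hw 0)]
  exact continuous_const.add (intervalIntegral.continuous_primitive hh 0)

/-- The product rule for two functions given as primitives. -/
lemma mul_eq_add_integral {w h c g : ℝ → ℂ} (hh : ∀ a b, IntervalIntegrable h volume a b)
    (hg : ∀ a b, IntervalIntegrable g volume a b)
    (hw : ∀ x₀ x, w x = w x₀ + ∫ y in x₀..x, h y)
    (hc : ∀ x₀ x, c x = c x₀ + ∫ y in x₀..x, g y) (x₀ x : ℝ) :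
    w x * c x = w x₀ * c x₀ + ∫ y in x₀..x, (h y * c y + w y * g y) := by
  wlog hle : x₀ ≤ x generalizing x₀ x
  · rw [this x x₀ (le_of_not_ge hle), intervalIntegral.integral_symm x₀ x]
    ring
  have hwc := continuous_of_eq_add_integral hh hw
  have hcc := continuous_of_eq_add_integral hg hc
  have hfub := integral_primitive_mul_eq hle (hh _ _) (hg _ _)
  have hleft : ∫ y in x₀..x, (∫ t in x₀..y, h t) * g y
      = (∫ y in x₀..x, w y * g y) - w x₀ * ∫ y in x₀..x, g y := by
    rw [← intervalIntegral.integral_const_mul, ← intervalIntegral.integral_sub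
      ((hg _ _).continuousOn_mul hwc.continuousOn) ((hg _ _).const_mul _)]
    refine intervalIntegral.integral_congr fun y _ => ?_
    simp only [hw x₀ y]
    ring
  have hright : ∫ y in x₀..x, h y * ∫ t in y..x, g t
      = c x * (∫ y in x₀..x, h y) - ∫ y in x₀..x, h y * c y := by
    rw [← intervalIntegral.integral_const_mul, ← intervalIntegral.integral_sub
      ((hh _ _).const_mul _) ((hh _ _).mul_continuousOn hcc.continuousOn)]
    refine intervalIntegral.integral_congr fun y _ => ?_
    simp only [hc y x]
    ring
  rw [hleft, hright] at hfub
  rw [intervalIntegral.integral_add ((hh _ _).mul_continuousOn hcc.continuousOn)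
    ((hg _ _).continuousOn_mul hwc.continuousOn)]
  linear_combination (c x) * hw x₀ x + (w x₀) * hc x₀ x - hfub

lemma intervalIntegral_apply {N : ℕ} {F : ℝ → Fin N → ℂ} {a b : ℝ}
    (hF : ∀ i, IntervalIntegrable (fun y => F y i) volume a b) (i : Fin N) :
    (∫ y in a..b, F y) i = ∫ y in a..b, F y i := by
  simp only [intervalIntegral, Pi.sub_apply]
  rw [eval_integral fun i => (hF i).1, eval_integral fun i => (hF i).2]

lemma intervalIntegrable_mulVec {N : ℕ} {L : ℝ → Matrix (Fin N) (Fin N) ℂ} {v : ℝ → Fin N → ℂ}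
    (hL : ∀ i j, LocallyIntegrable fun x => L x i j) (hv : Continuous v) (i : Fin N) (a b : ℝ) :
    IntervalIntegrable (fun y => (L y).mulVec (v y) i) volume a b := by
  have hsum : (fun y => (L y).mulVec (v y) i) = ∑ j, fun y => L y i j * v y j := by
    ext y
    simp [Matrix.mulVec, dotProduct]
  rw [hsum]
  exact IntervalIntegrable.sum _ fun j _ =>
    (((hL i j).integrableOn_isCompact isCompact_uIcc).intervalIntegrable).mul_continuousOn
    ((continuous_apply j).comp hv).continuousOn

lemma IsSolV.apply_eq_add_integral {N : ℕ} {L : ℝ → Matrix (Fin N) (Fin N) ℂ}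
    {v : ℝ → Fin N → ℂ} (hL : ∀ i j, LocallyIntegrable fun x => L x i j) (hv : IsSolV N L v)
    (i : Fin N) (x₀ x : ℝ) : v x i = v x₀ i + ∫ y in x₀..x, (L y).mulVec (v y) i := by
  conv_lhs => rw [hv.2 x₀ x]
  rw [Pi.add_apply, intervalIntegral_apply fun i => intervalIntegrable_mulVec hL hv.1 i _ _]

/-- Variation of constants: if the columns of `U` solve `u' = L u`, then `∑ j, c j • u j` solves
`v' = L v + f` as soon as `c' = g` with `U g = f`. -/
lemma variation_of_constants {N : ℕ} {L : ℝ → Matrix (Fin N) (Fin N) ℂ} {u : Fin N → ℝ → Fin N → ℂ}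
    (hL : ∀ i j, LocallyIntegrable fun x => L x i j) (hu : ∀ j, IsSolV N L (u j))
    {c g : Fin N → ℝ → ℂ} (hg : ∀ j, Continuous (g j))
    (hc : ∀ j x₀ x, c j x = c j x₀ + ∫ y in x₀..x, g j y)
    {f v : ℝ → Fin N → ℂ} (hf : Continuous f)
    (hgf : ∀ x k, ∑ j, u j x k * g j x = f x k) (hv : ∀ x k, v x k = ∑ j, u j x k * c j x) :
    Continuous v ∧ ∀ x₀ x : ℝ, v x = v x₀ + ∫ y in x₀..x, ((L y).mulVec (v y) + f y) := by
  have hcc j : Continuous (c j) :=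
    continuous_of_eq_add_integral (fun a b => (hg j).intervalIntegrable a b) (hc j)
  have huc j k : Continuous fun x => u j x k := (continuous_apply k).comp (hu j).1
  have hvc : Continuous v := by
    refine continuous_pi fun k => ?_
    simp only [hv]
    exact continuous_finsetSum _ fun j _ => (huc j k).mul (hcc j)
  refine ⟨hvc, fun x₀ x => ?_⟩
  have hfk k : Continuous fun x => f x k := (continuous_apply k).comp hf
  ext k
  rw [Pi.add_apply, intervalIntegral_apply (F := fun y => (L y).mulVec (v y) + f y) fun i =>
    (intervalIntegrable_mulVec hL hvc i _ _).add ((hfk i).intervalIntegrable _ _)]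
  have hsum : ∀ y, ((L y).mulVec (v y) + f y) k
      = ∑ j, ((L y).mulVec (u j y) k * c j y + u j y k * g j y) := by
    intro y
    rw [Finset.sum_add_distrib, hgf, Pi.add_apply]
    congr 1
    simp only [Matrix.mulVec, dotProduct, hv, Finset.mul_sum, Finset.sum_mul]
    rw [Finset.sum_comm]
    exact Finset.sum_congr rfl fun j _ => Finset.sum_congr rfl fun i _ => by ring
  simp only [hsum]
  rw [intervalIntegral.integral_finsetSum fun j _ =>
      ((intervalIntegrable_mulVec hL (hu j).1 k _ _).mul_continuousOn (hcc j).continuousOn).add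
        (((huc j k).fun_mul (hg j)).intervalIntegrable _ _),
    hv, hv, ← Finset.sum_add_distrib]
  exact Finset.sum_congr rfl fun j _ => mul_eq_add_integral
    (fun a b => intervalIntegrable_mulVec hL (hu j).1 k a b)
    (fun a b => (hg j).intervalIntegrable a b)
    (fun s t => (hu j).apply_eq_add_integral hL k s t) (hc j) x₀ x

lemma Continuous.matrix_nonsing_inv {N : ℕ} {U : ℝ → Matrix (Fin N) (Fin N) ℂ}
    (hU : Continuous U) (hdet : ∀ x, (U x).det ≠ 0) : Continuous fun x => (U x)⁻¹ := by
  simp only [Matrix.inv_def, Ring.inverse_eq_inv']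
  exact (hU.matrix_det.inv₀ hdet).smul hU.matrix_adjugate

lemma integral_Iic_isBigO_one {g : ℝ → ℂ} (hg : Integrable g) (l : Filter ℝ) :
    (fun x => ∫ y in Set.Iic x, g y) =O[l] fun _ => (1 : ℝ) :=
  IsBigO.of_bound (∫ y, ‖g y‖) <| .of_forall fun x => by
    simpa using (norm_integral_le_integral_norm _).trans
      (setIntegral_le_integral hg.norm (.of_forall fun _ => norm_nonneg _))

lemma integral_Ici_isBigO_one {g : ℝ → ℂ} (hg : Integrable g) (l : Filter ℝ) :
    (fun x => ∫ y in Set.Ici x, g y) =O[l] fun _ => (1 : ℝ) :=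
  IsBigO.of_bound (∫ y, ‖g y‖) <| .of_forall fun x => by
    simpa using (norm_integral_le_integral_norm _).trans
      (setIntegral_le_integral hg.norm (.of_forall fun _ => norm_nonneg _))

lemma integral_Iic_eventually_eq_zero {g : ℝ → ℂ} (hg : HasCompactSupport g) :
    ∀ᶠ x in atBot, ∫ y in Set.Iic x, g y = 0 := by
  obtain ⟨R, hR⟩ := hg.isCompact.bddBelow
  filter_upwards [eventually_lt_atBot R] with x hx
  exact setIntegral_eq_zero_of_forall_eq_zero fun y hy => image_eq_zero_of_notMem_tsupport
    fun hmem => (hx.trans_le (hR hmem)).not_ge hy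

lemma integral_Ici_eventually_eq_zero {g : ℝ → ℂ} (hg : HasCompactSupport g) :
    ∀ᶠ x in atTop, ∫ y in Set.Ici x, g y = 0 := by
  obtain ⟨R, hR⟩ := hg.isCompact.bddAbove
  filter_upwards [eventually_gt_atTop R] with x hx
  exact setIntegral_eq_zero_of_forall_eq_zero fun y hy => image_eq_zero_of_notMem_tsupport
    fun hmem => ((hR hmem).trans_lt hx).not_ge hy

/-- with `U(x)` the admissible fundamental matrix built from the solutions `u_j`
normalized by `u_j(x) = e^{ζ_j x} p_j` outside the support of `V`, the function
`φ(x) = −U(x) P₊ ∫_x^∞ U(y)⁻¹ f(y) dy + U(x) P₋ ∫_{−∞}^x U(y)⁻¹ f(y) dy` is continuous, solves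
`φ' = (L₀ + V(x)) φ + f` in the integrated sense, and decays like `e^{−ρ₊|x|}` as `x → −∞`
and like `e^{−ρ₋|x|}` as `x → +∞`. -/
theorem statement_2 (N n : ℕ) (hN : 1 ≤ N) (hn : n ≤ N)
    (L₀ : Matrix (Fin N) (Fin N) ℂ) (ζ : Fin N → ℂ) (p : Fin N → Fin N → ℂ)
    (hdist : Function.Injective ζ)
    (heig : ∀ j, L₀.mulVec (p j) = ζ j • p j) (hp0 : ∀ j, p j ≠ 0)
    (hre : ∀ j, (ζ j).re ≠ 0)
    (hpos : ∀ j : Fin N, (j : ℕ) < n → 0 < (ζ j).re)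
    (hneg : ∀ j : Fin N, n ≤ (j : ℕ) → (ζ j).re < 0)
    (a : ℝ) (ha : 0 < a)
    (V : ℝ → Matrix (Fin N) (Fin N) ℂ)
    (hVloc : ∀ i j : Fin N, MeasureTheory.LocallyIntegrable fun x : ℝ => V x i j)
    (hVsupp : ∀ x : ℝ, x ∉ Set.Icc (-a) a → V x = 0)
    (u : Fin N → ℝ → Fin N → ℂ)
    (husol : ∀ j, IsSolV N (fun x => L₀ + V x) (u j))
    (hbcm : ∀ j : Fin N, (j : ℕ) < n → ∀ x : ℝ, x < -a → u j x = Complex.exp (ζ j * x) • p j)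
    (hbcp : ∀ j : Fin N, n ≤ (j : ℕ) → ∀ x : ℝ, x > a → u j x = Complex.exp (ζ j * x) • p j)
    (U : ℝ → Matrix (Fin N) (Fin N) ℂ)
    (hU : ∀ x, U x = Matrix.of fun k j => u j x k)
    (hdet : ∀ x, (U x).det ≠ 0)
    (ρp ρm : ℝ)
    (hρp : IsLeast ((fun j => (ζ j).re) '' {j : Fin N | (j : ℕ) < n}) ρp)
    (hρm : IsLeast ((fun j => |(ζ j).re|) '' {j : Fin N | n ≤ (j : ℕ)}) ρm)
    (Pp Pm : Matrix (Fin N) (Fin N) ℂ)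
    (hPp : Pp = Matrix.diagonal fun j : Fin N => if (j : ℕ) < n then 1 else 0)
    (hPm : Pm = Matrix.diagonal fun j : Fin N => if (j : ℕ) < n then 0 else 1)
    (f : ℝ → Fin N → ℂ) (hf : Continuous f) (hfs : HasCompactSupport f)
    (φ : ℝ → Fin N → ℂ)
    (hφ : ∀ x : ℝ, φ x =
        -(U x * Pp).mulVec (∫ y in Set.Ici x, (U y)⁻¹.mulVec (f y))
          + (U x * Pm).mulVec (∫ y in Set.Iic x, (U y)⁻¹.mulVec (f y))) :
    Continuous φ ∧
    (∀ x₀ x : ℝ, φ x = φ x₀ + ∫ y in x₀..x, ((L₀ + V y).mulVec (φ y) + f y)) ∧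
    (φ =O[atBot] fun x : ℝ => Real.exp (-ρp * |x|)) ∧
    (φ =O[atTop] fun x : ℝ => Real.exp (-ρm * |x|)) := by
  set g : Fin N → ℝ → ℂ := fun j y => (U y)⁻¹.mulVec (f y) j with hg_def
  have hUc : Continuous U := by
    refine continuous_matrix fun k j => ?_
    simp only [hU, Matrix.of_apply]
    exact (continuous_apply k).comp (husol j).1
  have hgv : Continuous fun y => (U y)⁻¹.mulVec (f y) :=
    (hUc.matrix_nonsing_inv hdet).matrix_mulVec hf
  have hgc j : Continuous (g j) := (continuous_apply j).comp hgv
  have hgs j : HasCompactSupport (g j) := hfs.mono fun y hy hfy => hy (by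
    simp [hg_def, hfy])
  have hgi j : Integrable (g j) := (hgc j).integrable_of_hasCompactSupport (hgs j)
  set c : Fin N → ℝ → ℂ := fun j x =>
    if (j : ℕ) < n then -∫ y in Set.Ici x, g j y else ∫ y in Set.Iic x, g j y with hc_def
  have hφc x k : φ x k = ∑ j, u j x k * c j x := by
    have happly (M : Matrix (Fin N) (Fin N) ℂ) (w : Fin N → ℂ) :
        M.mulVec w k = ∑ j, M k j * w j := rfl
    simp only [hφ, hPp, hPm, Pi.add_apply, Pi.neg_apply, happly, Matrix.mul_diagonal, ← Finset.sum_neg_distrib, ← Finset.sum_add_distrib]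
    refine Finset.sum_congr rfl fun j _ => ?_
    rw [eval_integral fun i => (hgi i).integrableOn, eval_integral fun i => (hgi i).integrableOn,
      hU, Matrix.of_apply]
    by_cases hj : (j : ℕ) < n <;> simp [hc_def, hj, hg_def]
  have hc j x₀ x : c j x = c j x₀ + ∫ y in x₀..x, g j y := by
    by_cases hj : (j : ℕ) < n
    · simp only [hc_def, hj, if_true]
      rw [← intervalIntegral.integral_Ici_sub_Ici' (hgi j).integrableOn (hgi j).integrableOn]
      ring
    · simp only [hc_def, hj, if_false]
      rw [← intervalIntegral.integral_Iic_sub_Iic (hgi j).integrableOn (hgi j).integrableOn]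
      ring
  have hgf x k : ∑ j, u j x k * g j x = f x k := by
    have h : (U x).mulVec ((U x)⁻¹.mulVec (f x)) k = f x k := by
      rw [Matrix.mulVec_mulVec, Matrix.mul_nonsing_inv _ (hdet x).isUnit, Matrix.one_mulVec]
    rw [← h]
    conv_rhs => rw [Matrix.mulVec, dotProduct]
    simp only [hU, Matrix.of_apply, hg_def]
  have hL i j : LocallyIntegrable fun x => (L₀ + V x) i j :=
    (locallyIntegrable_const (L₀ i j)).add (hVloc i j)
  have hcO j (l : Filter ℝ) : c j =O[l] fun _ => (1 : ℝ) := by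
    by_cases hj : (j : ℕ) < n
    · simpa only [hc_def, hj, if_true] using (integral_Ici_isBigO_one (hgi j) l).neg_left
    · simpa only [hc_def, hj, if_false] using integral_Iic_isBigO_one (hgi j) l
  obtain ⟨hφcont, hφsol⟩ := variation_of_constants hL husol hgc hc hf hgf hφc
  refine ⟨hφcont, hφsol, isBigO_pi.2 fun k => ?_, isBigO_pi.2 fun k => ?_⟩
  · simp only [hφc]
    refine IsBigO.fun_sum fun j _ => ?_
    by_cases hj : (j : ℕ) < n
    · have hO : (fun x => u j x k) =O[atBot] fun x : ℝ => Real.exp (-ρp * |x|) := by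
        refine IsBigO.of_bound ‖p j k‖ ?_
        filter_upwards [eventually_lt_atBot (-a), eventually_lt_atBot 0] with x hxa hx0
        have hρ : ρp ≤ (ζ j).re := hρp.2 ⟨j, hj, rfl⟩
        rw [hbcm j hj x hxa, Pi.smul_apply, smul_eq_mul, norm_mul, Complex.norm_exp,
          Real.norm_of_nonneg (Real.exp_pos _).le, mul_comm, abs_of_neg hx0]
        gcongr
        simp only [Complex.re_mul_ofReal]
        nlinarith
      simpa using hO.mul (hcO j atBot)
    · refine IsBigO.of_bound 0 ?_
      filter_upwards [integral_Iic_eventually_eq_zero (hgs j)] with x hx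
      simp [hc_def, hj, hx]
  · simp only [hφc]
    refine IsBigO.fun_sum fun j _ => ?_
    by_cases hj : (j : ℕ) < n
    · refine IsBigO.of_bound 0 ?_
      filter_upwards [integral_Ici_eventually_eq_zero (hgs j)] with x hx
      simp [hc_def, hj, hx]
    · rw [not_lt] at hj
      have hO : (fun x => u j x k) =O[atTop] fun x : ℝ => Real.exp (-ρm * |x|) := by
        refine IsBigO.of_bound ‖p j k‖ ?_
        filter_upwards [eventually_gt_atTop a, eventually_gt_atTop 0] with x hxa hx0
        have hρ : ρm ≤ |(ζ j).re| := hρm.2 ⟨j, hj, rfl⟩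
        rw [abs_of_neg (hneg j hj)] at hρ
        rw [hbcp j hj x hxa, Pi.smul_apply, smul_eq_mul, norm_mul, Complex.norm_exp,
          Real.norm_of_nonneg (Real.exp_pos _).le, mul_comm, abs_of_pos hx0]
        gcongr
        simp only [Complex.re_mul_ofReal]
        nlinarith
      simpa using hO.mul (hcO j atTop)
end
end

section
/- For j = 1, …, n let t_{j,k} (k = 1, …, N) be the unique coefficients with u_j(x) = Σ_{k=1}^{N} t_{j,k} p_k e^{ζ_k x} for all x > a, and for j = n+1, …, N let t_{j,k} be the unique coefficients with u_j(x) = Σ_{k=1}^{N} t_{j,k} p_k e^{ζ_k x} for all x < −a. Set T₊ = (t_{j,k})_{1≤j,k≤n} and T₋ = (t_{j,k})_{n+1≤j,k≤N}. Then for every x ∈ ℝ, det U(x) = exp(tr(L₀)·x − ∫_{x}^{∞} tr V(y) dy) · det T₊ · det{p₁, …, p_N} and det U(x) = exp(tr(L₀)·x + ∫_{−∞}^{x} tr V(y) dy) · det T₋ · det{p₁, …, p_N}, where det{p₁, …, p_N} is the determinant of the matrix with columns p₁, …, p_N. -/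
open MeasureTheory Filter Topology

noncomputable section

/-- Post-composition with a `C¹` map preserves absolute continuity. -/
theorem AbsolutelyContinuousOnInterval.contDiff_comp {E F : Type*} [NormedAddCommGroup E]
    [NormedSpace ℝ E] [ProperSpace E] [NormedAddCommGroup F] [NormedSpace ℝ F]
    {f : ℝ → E} {g : E → F} {a b : ℝ} (hf : AbsolutelyContinuousOnInterval f a b)
    (hg : ContDiff ℝ 1 g) : AbsolutelyContinuousOnInterval (fun x => g (f x)) a b := by
  obtain ⟨C, hC⟩ := hf.exists_bound
  obtain ⟨K, hK⟩ := hg.contDiffOn.exists_lipschitzOnWith (by decide)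
    (convex_closedBall (0 : E) C) (isCompact_closedBall (0 : E) C)
  have h0 : Tendsto _ _ (𝓝 ((K : ℝ) * 0)) := Tendsto.const_mul (K : ℝ) hf
  rw [mul_zero] at h0
  refine squeeze_zero' (Eventually.of_forall fun E => Finset.sum_nonneg fun _ _ => dist_nonneg)
    ?_ h0
  filter_upwards [mem_inf_of_right (mem_principal_self _)] with E hE
  rw [Finset.mul_sum]
  refine Finset.sum_le_sum fun i hi => hK.dist_le_mul _ ?_ _ ?_
  · simpa using hC _ (hE.1 i hi).1
  · simpa using hC _ (hE.1 i hi).2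

/-- The primitive of a locally integrable vector-valued function is absolutely continuous. -/
theorem MeasureTheory.LocallyIntegrable.absolutelyContinuousOnInterval_integral {E : Type*}
    [NormedAddCommGroup E] [NormedSpace ℝ E] {f : ℝ → E} (hf : LocallyIntegrable f)
    (v : E) (a b : ℝ) :
    AbsolutelyContinuousOnInterval (fun x => v + ∫ y in a..x, f y) a b := by
  have hi (c d : ℝ) : IntervalIntegrable f volume c d :=
    (hf.integrableOn_isCompact isCompact_uIcc).intervalIntegrable
  have hn := (hi a b).norm.absolutelyContinuousOnInterval_intervalIntegral Set.left_mem_uIcc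
  refine squeeze_zero (fun E => Finset.sum_nonneg fun _ _ => dist_nonneg)
    (fun E => Finset.sum_le_sum fun i _ => ?_) hn
  rw [dist_add_left, dist_eq_norm, Real.dist_eq,
    intervalIntegral.integral_interval_sub_left (hi _ _) (hi _ _),
    intervalIntegral.integral_interval_sub_left (hi _ _).norm (hi _ _).norm]
  exact intervalIntegral.norm_integral_le_abs_integral_norm

section Det

variable {m : Type*} [Fintype m] [DecidableEq m]

theorem Matrix.hasDerivAt_det_one_add_smul (A : Matrix m m ℂ) :
    HasDerivAt (fun r : ℝ => (1 + (r : ℂ) • A).det) A.trace 0 := by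
  have h := ((1 + (Polynomial.X : Polynomial ℂ) • A.map Polynomial.C).det).hasDerivAt (0 : ℂ)
  rw [Matrix.derivative_det_one_add_X_smul] at h
  have h' := HasDerivAt.comp_ofReal (z := 0) (by simpa using h)
  refine h'.congr_of_eventuallyEq (Eventually.of_forall fun r => ?_)
  simp only [← Polynomial.coe_evalRingHom, RingHom.map_det]
  congr 1
  ext i j
  by_cases hij : i = j <;> simp [hij, mul_comm (r : ℂ)]

theorem Matrix.contDiff_det : ContDiff ℝ 1 fun w : m → m → ℂ => (Matrix.of w).det := by
  simp only [Matrix.det_apply', Matrix.of_apply]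
  fun_prop

/-- Jacobi's formula along a curve whose velocity is `A` times its position. -/
theorem Matrix.hasDerivAt_det {w : ℝ → m → m → ℂ} {w' : m → m → ℂ} {A : Matrix m m ℂ} {s : ℝ}
    (hw : HasDerivAt w w' s) (hA : Matrix.of w' = A * Matrix.of (w s)) :
    HasDerivAt (fun x => (Matrix.of (w x)).det) (A.trace * (Matrix.of (w s)).det) s := by
  have hd := ((Matrix.contDiff_det (m := m)).differentiable one_ne_zero (w s)).hasFDerivAt
  have hline : HasDerivAt (fun r : ℝ => w s + r • w') w' 0 := by
    simpa using ((hasDerivAt_id (0 : ℝ)).smul_const w').const_add (w s)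
  have hd0 := hd
  rw [show w s = w s + (0 : ℝ) • w' by simp] at hd0
  have h1 := hd0.comp_hasDerivAt (0 : ℝ) hline
  have h2 := (Matrix.hasDerivAt_det_one_add_smul A).mul_const (Matrix.of (w s)).det
  have h3 := h1.unique (h2.congr_of_eventuallyEq (Eventually.of_forall fun r => ?_))
  · rw [← h3, show w s + (0 : ℝ) • w' = w s by simp]
    exact hd.comp_hasDerivAt s hw
  · simp only [Function.comp_apply]
    rw [← Matrix.det_mul, add_mul, one_mul, smul_mul_assoc, ← hA]
    rfl

/-- Liouville's formula for a linear system with locally integrable coefficients. -/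
theorem Matrix.det_eq_det_mul_exp_integral_trace {A W : ℝ → Matrix m m ℂ}
    (hA : ∀ i j, LocallyIntegrable fun x => A x i j) (hW : ∀ i j, Continuous fun x => W x i j)
    (hsol : ∀ i j x₀ x, W x i j = W x₀ i j + ∫ y in x₀..x, (A y * W y) i j) (x y : ℝ) :
    (W y).det = (W x).det * Complex.exp (∫ s in x..y, (A s).trace) := by
  let g : ℝ → (m → m → ℂ) × ℂ := fun s => (fun i j => (A s * W s) i j, (A s).trace)
  have hentry (i j : m) : LocallyIntegrable fun s => (A s * W s) i j := by
    simp only [Matrix.mul_apply]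
    refine locallyIntegrable_finsetSum _ fun k _ => ?_
    simpa [mul_comm] using (hA i k).smul_continuous (hW k j)
  have htr : LocallyIntegrable fun s => (A s).trace :=
    locallyIntegrable_finsetSum _ fun k _ => hA k k
  have hg1 : LocallyIntegrable fun s => (fun i j => (A s * W s) i j : m → m → ℂ) := by
    rw [locallyIntegrable_iff]
    intro K hK
    refine Integrable.of_eval fun i => Integrable.of_eval fun j => ?_
    exact (hentry i j).integrableOn_isCompact hK
  have hg : LocallyIntegrable g := by
    rw [locallyIntegrable_iff]
    intro K hK
    exact (hg1.integrableOn_isCompact hK).prodMk (htr.integrableOn_isCompact hK)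
  have hgi (c d : ℝ) : IntervalIntegrable g volume c d :=
    (hg.integrableOn_isCompact isCompact_uIcc).intervalIntegrable
  let f : ℝ → (m → m → ℂ) × ℂ := fun s => (fun i j => W x i j, 0) + ∫ r in x..s, g r
  have hf1 (s : ℝ) : (f s).1 = fun i j => W s i j := by
    ext i j
    let P : (m → m → ℂ) × ℂ →L[ℝ] ℂ := (ContinuousLinearMap.proj (R := ℝ) j).comp
      ((ContinuousLinearMap.proj (R := ℝ) i).comp (ContinuousLinearMap.fst ℝ (m → m → ℂ) ℂ))
    have := P.intervalIntegral_comp_comm (hgi x s)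
    rw [hsol i j x s]
    exact congrArg (W x i j + ·) this.symm
  have hf2 (s : ℝ) : (f s).2 = ∫ r in x..s, (A r).trace := by
    have := (ContinuousLinearMap.snd ℝ (m → m → ℂ) ℂ).intervalIntegral_comp_comm (hgi x s)
    simpa [f, g] using this.symm
  let G : (m → m → ℂ) × ℂ → ℂ := fun q => (Matrix.of q.1).det * Complex.exp (-q.2)
  have hG : ContDiff ℝ 1 G :=
    (Matrix.contDiff_det.comp contDiff_fst).mul
      ((Complex.contDiff_exp (𝕜 := ℝ)).comp contDiff_snd.neg)
  have hac : AbsolutelyContinuousOnInterval (fun s => G (f s)) x y :=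
    (hg.absolutelyContinuousOnInterval_integral _ x y).contDiff_comp hG
  have hzero : ∀ᵐ s, s ∈ Set.uIcc x y → HasDerivAt (fun s => G (f s)) 0 s := by
    filter_upwards [_root_.LocallyIntegrable.ae_hasDerivAt_integral hg] with s hs _
    have hfs : HasDerivAt f (g s) s := (hs x).const_add _
    have hw : HasDerivAt (fun r => (f r).1) (g s).1 s := hfs.fst
    have hz : HasDerivAt (fun r => (f r).2) (g s).2 s := hfs.snd
    have hd := Matrix.hasDerivAt_det (w := fun r => (f r).1) hw
      (A := A s) (by rw [hf1]; rfl)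
    have := hd.mul hz.neg.cexp
    convert! this using 1
    simp only [g]
    ring
  obtain ⟨C, hC⟩ := hac.const_of_ae_hasDerivAt_zero hzero
  have h := (hC y Set.right_mem_uIcc).trans (hC x Set.left_mem_uIcc).symm
  have hx : G (f x) = (W x).det := by simp [G, hf1, hf2]; rfl
  have hy : G (f y) = (W y).det * Complex.exp (-∫ s in x..y, (A s).trace) := by
    simp [G, hf1, hf2]; rfl
  rw [hx, hy] at h
  rw [← h, mul_assoc, ← Complex.exp_add, neg_add_cancel, Complex.exp_zero, mul_one]

end Det

section Eigenvectors

open scoped Matrix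

variable {m : Type*} [Fintype m] [DecidableEq m]

/-- The trace is the sum of the eigenvalues when these are distinct and exhaust the dimension. -/
theorem Matrix.trace_eq_sum_of_eigenvectors {L : Matrix m m ℂ} {ζ : m → ℂ} {p : m → m → ℂ}
    (hζ : Function.Injective ζ) (hp : ∀ j, L.mulVec (p j) = ζ j • p j) (hp0 : ∀ j, p j ≠ 0) :
    L.trace = ∑ j, ζ j := by
  have hli : LinearIndependent ℂ p :=
    Module.End.eigenvectors_linearIndependent' (Matrix.toLin' L) ζ hζ p fun j =>
      ⟨Module.End.mem_eigenspace_iff.mpr (by simpa using hp j), hp0 j⟩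
  have hunit : IsUnit (Matrix.of p)ᵀ :=
    (Matrix.isUnit_transpose _).mpr (Matrix.linearIndependent_rows_iff_isUnit.mp hli)
  have hmul : L * (Matrix.of p)ᵀ = (Matrix.of p)ᵀ * Matrix.diagonal ζ := by
    ext i j
    rw [Matrix.mul_diagonal]
    simpa [Matrix.mul_apply, Matrix.mulVec, dotProduct, mul_comm] using congrFun (hp j) i
  have hdet := (Matrix.isUnit_iff_isUnit_det _).mp hunit
  have hL : L = (Matrix.of p)ᵀ * Matrix.diagonal ζ * (Matrix.of p)ᵀ⁻¹ := by
    rw [← hmul, Matrix.mul_nonsing_inv_cancel_right _ _ hdet]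
  rw [hL, Matrix.trace_mul_comm, ← mul_assoc, Matrix.nonsing_inv_mul _ hdet, one_mul,
    Matrix.trace_diagonal]

/-- The Wronskian of combinations of the free solutions `exp (ζ k * x) • p k`. -/
theorem Matrix.det_of_sum_exp_smul (ζ : m → ℂ) (p c w : m → m → ℂ) (x : ℝ)
    (hw : ∀ j, w j = ∑ k, (c j k * Complex.exp (ζ k * x)) • p k) :
    (Matrix.of fun k j => w j k).det =
      Complex.exp ((∑ k, ζ k) * x) * (Matrix.of c).det * (Matrix.of fun k j => p j k).det := by
  have h : (Matrix.of fun k j => w j k) = (Matrix.of fun k j => p j k) *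
      Matrix.diagonal (fun k => Complex.exp (ζ k * x)) * (Matrix.of c)ᵀ := by
    ext i j
    rw [Matrix.mul_apply]
    simp only [Matrix.of_apply, hw, Matrix.mul_diagonal, Matrix.transpose_apply,
      Finset.sum_apply, Pi.smul_apply, smul_eq_mul]
    exact Finset.sum_congr rfl fun k _ => by ring
  rw [h, Matrix.det_mul, Matrix.det_mul, Matrix.det_diagonal, Matrix.det_transpose,
    ← Complex.exp_sum, Finset.sum_mul]
  ring

end Eigenvectors

/-- Determinant of a matrix whose last rows are those of the identity. -/
theorem Matrix.det_of_ite_lt {N n : ℕ} (hn : n ≤ N) (t : Fin N → Fin N → ℂ) :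
    (Matrix.of fun j k : Fin N => if (j : ℕ) < n then t j k else (1 : Matrix _ _ ℂ) j k).det =
      (Matrix.of fun j k : Fin n =>
        t ⟨j, lt_of_lt_of_le j.2 hn⟩ ⟨k, lt_of_lt_of_le k.2 hn⟩).det := by
  let e : Fin n ≃ {i : Fin N // (i : ℕ) < n} :=
    { toFun := fun i => ⟨⟨i, lt_of_lt_of_le i.2 hn⟩, i.2⟩
      invFun := fun i => ⟨i.1, i.2⟩
      left_inv := fun _ => rfl
      right_inv := fun _ => rfl }
  rw [Matrix.twoBlockTriangular_det _ fun i : Fin N => (i : ℕ) < n]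
  · have h1 : Matrix.toSquareBlockProp (Matrix.of fun j k : Fin N =>
        if (j : ℕ) < n then t j k else (1 : Matrix _ _ ℂ) j k) (fun i => ¬ (i : ℕ) < n) = 1 := by
      ext ⟨i, hi⟩ ⟨j, hj⟩
      simp [Matrix.toSquareBlockProp_def, hi, Matrix.one_apply]
    rw [h1, Matrix.det_one, mul_one, ← Matrix.det_submatrix_equiv_self e]
    congr 1
    ext i j
    simp [Matrix.toSquareBlockProp_def, e]
  · intro i hi j hj
    have hij : i ≠ j := by rintro rfl; exact hi hj
    simp [hi, hij]

/-- Determinant of a matrix whose first rows are those of the identity. -/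
theorem Matrix.det_of_ite_le {N n : ℕ} (t : Fin N → Fin N → ℂ) (f : Fin (N - n) → Fin N)
    (hf : ∀ j, (f j : ℕ) = n + j) :
    (Matrix.of fun j k : Fin N => if n ≤ (j : ℕ) then t j k else (1 : Matrix _ _ ℂ) j k).det =
      (Matrix.of fun j k : Fin (N - n) => t (f j) (f k)).det := by
  let e : Fin (N - n) ≃ {i : Fin N // n ≤ (i : ℕ)} :=
    { toFun := fun i => ⟨f i, by rw [hf]; exact Nat.le_add_right _ _⟩
      invFun := fun i => ⟨i.1 - n, by have := i.2; omega⟩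
      left_inv := fun _ => by ext; simp [hf]
      right_inv := fun i => by ext; simp [hf, i.2] }
  rw [Matrix.twoBlockTriangular_det _ fun i : Fin N => n ≤ (i : ℕ)]
  · have h1 : Matrix.toSquareBlockProp (Matrix.of fun j k : Fin N =>
        if n ≤ (j : ℕ) then t j k else (1 : Matrix _ _ ℂ) j k) (fun i => ¬ n ≤ (i : ℕ)) = 1 := by
      ext ⟨i, hi⟩ ⟨j, hj⟩
      simp [Matrix.toSquareBlockProp_def, hi, Matrix.one_apply]
    rw [h1, Matrix.det_one, mul_one, ← Matrix.det_submatrix_equiv_self e]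
    congr 1
    ext i j
    simp [Matrix.toSquareBlockProp_def, e, hf]
  · intro i hi j hj
    have hij : i ≠ j := by rintro rfl; exact hi hj
    simp [hi, hij]

theorem setIntegral_Ici_eq_intervalIntegral {f : ℝ → ℂ} {x y : ℝ} (hxy : x ≤ y)
    (hf : ∀ s, y < s → f s = 0) : ∫ s in Set.Ici x, f s = ∫ s in x..y, f s := by
  rw [intervalIntegral.integral_of_le hxy, integral_Ici_eq_integral_Ioi]
  refine setIntegral_eq_of_subset_of_forall_sdiff_eq_zero measurableSet_Ioi
    Set.Ioc_subset_Ioi_self fun s hs => hf s ?_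
  by_contra! h
  exact hs.2 ⟨hs.1, h⟩

theorem setIntegral_Iic_eq_intervalIntegral {f : ℝ → ℂ} {x y : ℝ} (hyx : y ≤ x)
    (hf : ∀ s, s ≤ y → f s = 0) : ∫ s in Set.Iic x, f s = ∫ s in y..x, f s := by
  rw [intervalIntegral.integral_of_le hyx]
  refine setIntegral_eq_of_subset_of_forall_sdiff_eq_zero measurableSet_Iic
    Set.Ioc_subset_Iic_self fun s hs => hf s ?_
  by_contra! h
  exact hs.2 ⟨h, hs.1⟩

/-- in terms of the transition coefficients `t_{j,k}` (defined by
`u_j(x) = Σ_k t_{j,k} p_k e^{ζ_k x}` for `x > a` when `j ≤ n` and for `x < −a` when `j > n`),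
the Wronskian `det U(x)` equals
`exp(tr L₀ · x − ∫_x^∞ tr V) · det T₊ · det{p₁,…,p_N}` and also
`exp(tr L₀ · x + ∫_{−∞}^x tr V) · det T₋ · det{p₁,…,p_N}`. -/
theorem statement_3 (N n : ℕ) (hN : 1 ≤ N) (hn : n ≤ N)
    (L₀ : Matrix (Fin N) (Fin N) ℂ) (ζ : Fin N → ℂ) (p : Fin N → Fin N → ℂ)
    (hdist : Function.Injective ζ)
    (heig : ∀ j, L₀.mulVec (p j) = ζ j • p j) (hp0 : ∀ j, p j ≠ 0)
    (hre : ∀ j, (ζ j).re ≠ 0)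
    (hpos : ∀ j : Fin N, (j : ℕ) < n → 0 < (ζ j).re)
    (hneg : ∀ j : Fin N, n ≤ (j : ℕ) → (ζ j).re < 0)
    (a : ℝ) (ha : 0 < a)
    (V : ℝ → Matrix (Fin N) (Fin N) ℂ)
    (hVloc : ∀ i j : Fin N, MeasureTheory.LocallyIntegrable fun x : ℝ => V x i j)
    (hVsupp : ∀ x : ℝ, x ∉ Set.Icc (-a) a → V x = 0)
    (u : Fin N → ℝ → Fin N → ℂ)
    (husol : ∀ j, IsSolV N (fun x => L₀ + V x) (u j))
    (hbcm : ∀ j : Fin N, (j : ℕ) < n → ∀ x : ℝ, x < -a → u j x = Complex.exp (ζ j * x) • p j)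
    (hbcp : ∀ j : Fin N, n ≤ (j : ℕ) → ∀ x : ℝ, x > a → u j x = Complex.exp (ζ j * x) • p j)
    (U : ℝ → Matrix (Fin N) (Fin N) ℂ)
    (hU : ∀ x, U x = Matrix.of fun k j => u j x k)
    (t : Fin N → Fin N → ℂ)
    (htp : ∀ j : Fin N, (j : ℕ) < n → ∀ x : ℝ, x > a →
      u j x = ∑ k : Fin N, (t j k * Complex.exp (ζ k * x)) • p k)
    (htm : ∀ j : Fin N, n ≤ (j : ℕ) → ∀ x : ℝ, x < -a →
      u j x = ∑ k : Fin N, (t j k * Complex.exp (ζ k * x)) • p k)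
    (Tp : Matrix (Fin n) (Fin n) ℂ)
    (hTp : Tp = Matrix.of fun j k : Fin n =>
      t ⟨j, lt_of_lt_of_le j.2 hn⟩ ⟨k, lt_of_lt_of_le k.2 hn⟩)
    (Tm : Matrix (Fin (N - n)) (Fin (N - n)) ℂ)
    (hTm : Tm = Matrix.of fun j k : Fin (N - n) =>
      t ⟨n + j, by omega⟩ ⟨n + k, by omega⟩)
    (x : ℝ) :
    (U x).det = Complex.exp (L₀.trace * x - ∫ y in Set.Ici x, (V y).trace) *
        Tp.det * (Matrix.of fun k j : Fin N => p j k).det ∧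
    (U x).det = Complex.exp (L₀.trace * x + ∫ y in Set.Iic x, (V y).trace) *
        Tm.det * (Matrix.of fun k j : Fin N => p j k).det := by
  have hAloc (i j : Fin N) : LocallyIntegrable fun s => (L₀ + V s) i j :=
    (locallyIntegrable_const (L₀ i j)).add (hVloc i j)
  have hUc (i j : Fin N) : Continuous fun s => U s i j := by
    simpa [hU, Function.comp_def] using (continuous_apply i).comp (husol j).1
  have hcol (j : Fin N) (s : ℝ) : (L₀ + V s).mulVec (u j s) =
      fun i => ((L₀ + V s) * U s) i j := by
    ext i
    simp [Matrix.mulVec, dotProduct, Matrix.mul_apply, hU]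
  have hUsol (i j : Fin N) (x₀ y : ℝ) :
      U y i j = U x₀ i j + ∫ s in x₀..y, ((L₀ + V s) * U s) i j := by
    have hint : IntervalIntegrable (fun s => (L₀ + V s).mulVec (u j s)) volume x₀ y := by
      rw [intervalIntegrable_iff]
      refine Integrable.of_eval fun k => ?_
      simp only [hcol, Matrix.mul_apply]
      refine integrable_finsetSum _ fun l _ => ?_
      have : LocallyIntegrable fun s => (L₀ + V s) k l * U s l j := by
        simpa [mul_comm] using (hAloc k l).smul_continuous (hUc l j)
      exact (this.integrableOn_isCompact isCompact_uIcc).mono_set Set.uIoc_subset_uIcc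
    have h1 := congrFun ((husol j).2 x₀ y) i
    have h2 := (ContinuousLinearMap.proj (R := ℝ) (φ := fun _ : Fin N => ℂ)
      i).intervalIntegral_comp_comm hint
    simp only [hcol, ContinuousLinearMap.proj_apply] at h1 h2
    rw [hU, hU, Matrix.of_apply, Matrix.of_apply, h1, Pi.add_apply, h2]
  have htr (x₀ y : ℝ) : ∫ s in x₀..y, (L₀ + V s).trace =
      L₀.trace * (y - x₀) + ∫ s in x₀..y, (V s).trace := by
    have hV : LocallyIntegrable fun s => (V s).trace :=
      locallyIntegrable_finsetSum _ fun k _ => hVloc k k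
    simp only [Matrix.trace_add]
    rw [intervalIntegral.integral_add intervalIntegrable_const
      (hV.integrableOn_isCompact isCompact_uIcc).intervalIntegrable]
    simp [mul_comm]
  have hdet (y : ℝ) : (U x).det = (U y).det * Complex.exp (∫ s in y..x, (L₀ + V s).trace) :=
    Matrix.det_eq_det_mul_exp_integral_trace hAloc hUc hUsol y x
  have hsum := Matrix.trace_eq_sum_of_eigenvectors hdist heig hp0
  have hVtr (s : ℝ) (hs : s ∉ Set.Icc (-a) a) : (V s).trace = 0 := by simp [hVsupp s hs]
  constructor
  · obtain ⟨y, hy⟩ := exists_gt (max x a)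
    have hxy : x < y := (le_max_left _ _).trans_lt hy
    have hay : a < y := (le_max_right _ _).trans_lt hy
    have hUy := Matrix.det_of_sum_exp_smul ζ p
      (fun j k => if (j : ℕ) < n then t j k else (1 : Matrix _ _ ℂ) j k) (fun j => u j y) y
      fun j => by
        by_cases hj : (j : ℕ) < n
        · simpa [hj] using htp j hj y hay
        · simpa [hj, Matrix.one_apply, ite_smul] using hbcp j (not_lt.mp hj) y hay
    rw [← hU, Matrix.det_of_ite_lt hn, ← hTp, ← hsum] at hUy
    rw [hdet y, hUy, htr, intervalIntegral.integral_symm, setIntegral_Ici_eq_intervalIntegral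
      hxy.le fun s hs => hVtr s fun h => (hay.trans hs).not_ge h.2]
    have he : Complex.exp (L₀.trace * x - ∫ s in x..y, (V s).trace) =
        Complex.exp (L₀.trace * y) *
          Complex.exp (L₀.trace * (x - y) + -∫ s in x..y, (V s).trace) := by
      rw [← Complex.exp_add]
      congr 1
      ring
    rw [he]
    ring
  · obtain ⟨y, hy⟩ := exists_lt (min x (-a))
    have hyx : y < x := hy.trans_le (min_le_left _ _)
    have hya : y < -a := hy.trans_le (min_le_right _ _)
    have hUy := Matrix.det_of_sum_exp_smul ζ p
      (fun j k => if n ≤ (j : ℕ) then t j k else (1 : Matrix _ _ ℂ) j k) (fun j => u j y) y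
      fun j => by
        by_cases hj : n ≤ (j : ℕ)
        · simpa [hj] using htm j hj y hya
        · simpa [hj, Matrix.one_apply, ite_smul] using hbcm j (not_le.mp hj) y hya
    rw [← hU, Matrix.det_of_ite_le t (fun j => ⟨n + j, by omega⟩) fun _ => rfl, ← hTm, ← hsum] at hUy
    rw [hdet y, hUy, htr, setIntegral_Iic_eq_intervalIntegral hyx.le
      fun s hs => hVtr s fun h => (hs.trans_lt hya).not_ge h.1]
    have he : Complex.exp (L₀.trace * x + ∫ s in y..x, (V s).trace) =
        Complex.exp (L₀.trace * y) *
          Complex.exp (L₀.trace * (x - y) + ∫ s in y..x, (V s).trace) := by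
      rw [← Complex.exp_add]
      congr 1
      ring
    rw [he]
    ring
end
end

section
/- Let U₀(x) be the matrix with columns p₁ e^{ζ₁ x}, …, p_N e^{ζ_N x} and let G⁰(x) = U₀(x)⁻¹ with entries g⁰_{j,l}(x); let G(x) = U(x)⁻¹ with entries g_{j,l}(x). Then for every l = 1, …, N: g_{j,l}(x) − g⁰_{j,l}(x) = O(e^{−ρ₊ x}) as x → +∞ for each j = n+1, …, N, and g_{j,l}(x) − g⁰_{j,l}(x) = O(e^{ρ₋ x}) as x → −∞ for each j = 1, …, n. -/
open MeasureTheory Filter Topology Asymptotics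

noncomputable section

/-- Away from the potential, a solution in the integrated sense is differentiable. -/
lemma IsSolV.hasDerivAt {N : ℕ} {L₀ : Matrix (Fin N) (Fin N) ℂ}
    {V : ℝ → Matrix (Fin N) (Fin N) ℂ} {w : ℝ → Fin N → ℂ}
    (hw : IsSolV N (fun x => L₀ + V x) w) {s : Set ℝ} (hs : IsOpen s) (hs' : s.OrdConnected)
    (hV : ∀ x ∈ s, V x = 0) {x : ℝ} (hx : x ∈ s) :
    HasDerivAt w (L₀.mulVec (w x)) x := by
  have hcont : Continuous fun y => L₀.mulVec (w y) := continuous_const.matrix_mulVec hw.1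
  have hFTC : HasDerivAt (fun y => w x + ∫ t in x..y, L₀.mulVec (w t)) (L₀.mulVec (w x)) x :=
    (intervalIntegral.integral_hasDerivAt_right (hcont.intervalIntegrable _ _)
      (hcont.stronglyMeasurableAtFilter _ _) hcont.continuousAt).const_add _
  refine hFTC.congr_of_eventuallyEq ?_
  filter_upwards [hs.mem_nhds hx] with y hy
  rw [hw.2 x y]
  congr 1
  refine intervalIntegral.integral_congr fun t ht => ?_
  simp [hV t (hs'.uIcc_subset hx hy ht)]

/-- A matrix whose columns are eigenvectors for distinct eigenvalues is invertible. -/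
lemma isUnit_of_eigenvector_cols {N : ℕ} {L₀ : Matrix (Fin N) (Fin N) ℂ} {ζ : Fin N → ℂ}
    {p : Fin N → Fin N → ℂ} (hdist : Function.Injective ζ)
    (heig : ∀ j, L₀.mulVec (p j) = ζ j • p j) (hp0 : ∀ j, p j ≠ 0) :
    IsUnit (Matrix.of fun k j => p j k) := by
  rw [← Matrix.linearIndependent_cols_iff_isUnit]
  refine Module.End.eigenvectors_linearIndependent' (Matrix.toLin' L₀) ζ hdist p fun j => ?_
  exact ⟨Module.End.mem_eigenspace_iff.2 (by simpa using heig j), hp0 j⟩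

/-- Off the support of the potential, `exp (-ζ_i x)` times the `i`-th coordinate of a solution in
the eigenbasis is constant. -/
lemma exp_mul_eigencoord_eq {N : ℕ} {L₀ P : Matrix (Fin N) (Fin N) ℂ} {ζ : Fin N → ℂ}
    (hP : IsUnit P) (hLP : L₀ * P = P * Matrix.diagonal ζ)
    {w : ℝ → Fin N → ℂ} {s : Set ℝ} (hs : IsOpen s) (hs' : s.OrdConnected)
    (hw : ∀ x ∈ s, HasDerivAt w (L₀.mulVec (w x)) x) (i : Fin N) {x y : ℝ}
    (hx : x ∈ s) (hy : y ∈ s) :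
    Complex.exp (-(ζ i * x)) * (P⁻¹.mulVec (w x)) i =
      Complex.exp (-(ζ i * y)) * (P⁻¹.mulVec (w y)) i := by
  have hdet : IsUnit P.det := (Matrix.isUnit_iff_isUnit_det P).1 hP
  have hPL : P⁻¹ * L₀ = Matrix.diagonal ζ * P⁻¹ := by
    calc P⁻¹ * L₀ = P⁻¹ * (L₀ * P) * P⁻¹ := by
          rw [Matrix.mul_assoc, Matrix.mul_assoc, Matrix.mul_nonsing_inv _ hdet, Matrix.mul_one]
      _ = Matrix.diagonal ζ * P⁻¹ := by
          rw [hLP, ← Matrix.mul_assoc, Matrix.nonsing_inv_mul _ hdet, Matrix.one_mul]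
  have hderiv : ∀ t ∈ s, HasDerivAt
      (fun t : ℝ => Complex.exp (-(ζ i * t)) * (P⁻¹.mulVec (w t)) i) 0 t := by
    intro t ht
    have hcoord : HasDerivAt (fun t => (P⁻¹.mulVec (w t)) i)
        (ζ i * (P⁻¹.mulVec (w t)) i) t := by
      have hval : (P⁻¹.mulVec (L₀.mulVec (w t))) i = ζ i * (P⁻¹.mulVec (w t)) i := by
        rw [Matrix.mulVec_mulVec, hPL, ← Matrix.mulVec_mulVec, Matrix.mulVec_diagonal]
      rw [← hval]
      simp only [Matrix.mulVec, dotProduct]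
      exact HasDerivAt.fun_sum fun k _ => ((hasDerivAt_pi.1 (hw t ht) k).const_mul _)
    have hexp : HasDerivAt (fun t : ℝ => Complex.exp (-(ζ i * t)))
        (Complex.exp (-(ζ i * t)) * -(ζ i * 1)) t :=
      (((hasDerivAt_id t).ofReal_comp.const_mul (ζ i)).neg).cexp
    refine (hexp.mul hcoord).congr_deriv ?_
    ring
  exact hs.is_const_of_deriv_eq_zero hs'.isPreconnected
    (fun t ht => (hderiv t ht).differentiableAt.differentiableWithinAt)
    (fun t ht => (hderiv t ht).deriv) hx hy

/-- Comparison of inverse fundamental matrices on an interval `s` off the support of the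
potential: if the solutions indexed by the complement of `T` are the free exponentials on `s`, then
the rows of `U⁻¹ - U₀⁻¹` outside `T` are `O(f)` whenever `exp (-κ_i x)` is for every `i ∈ T`. -/
lemma inv_sub_free_inv_isBigO {N : ℕ} {L₀ : Matrix (Fin N) (Fin N) ℂ} {ζ : Fin N → ℂ}
    {p : Fin N → Fin N → ℂ} (hdist : Function.Injective ζ)
    (heig : ∀ j, L₀.mulVec (p j) = ζ j • p j) (hp0 : ∀ j, p j ≠ 0)
    {V : ℝ → Matrix (Fin N) (Fin N) ℂ} {u : Fin N → ℝ → Fin N → ℂ}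
    (husol : ∀ j, IsSolV N (fun x => L₀ + V x) (u j))
    {U U₀ : ℝ → Matrix (Fin N) (Fin N) ℂ}
    (hU : ∀ x, U x = Matrix.of fun k j => u j x k)
    (hdet : ∀ x, (U x).det ≠ 0)
    (hU₀ : ∀ x, U₀ x = Matrix.of fun k j => Complex.exp (ζ j * x) * p j k)
    {s : Set ℝ} (hs : IsOpen s) (hs' : s.OrdConnected) (hV : ∀ x ∈ s, V x = 0)
    {F : Filter ℝ} (hsF : s ∈ F) [F.NeBot] {T : Set (Fin N)}
    (hbc : ∀ j ∉ T, ∀ x ∈ s, u j x = Complex.exp (ζ j * x) • p j)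
    {f : ℝ → ℝ} (hf : ∀ i ∈ T, (fun x : ℝ => Real.exp (-((ζ i).re * x))) =O[F] f)
    {j : Fin N} (hj : j ∉ T) (l : Fin N) :
    (fun x : ℝ => (U x)⁻¹ j l - (U₀ x)⁻¹ j l) =O[F] f := by
  obtain ⟨x₀, hx₀⟩ := F.nonempty_of_mem hsF
  set P : Matrix (Fin N) (Fin N) ℂ := Matrix.of fun k j => p j k with hPdef
  have hP : IsUnit P := isUnit_of_eigenvector_cols hdist heig hp0
  have hPdet : IsUnit P.det := (Matrix.isUnit_iff_isUnit_det P).1 hP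
  have hLP : L₀ * P = P * Matrix.diagonal ζ := by
    ext k j
    rw [Matrix.mul_diagonal]
    simpa [Matrix.mul_apply, Matrix.mulVec, dotProduct, hPdef, mul_comm] using
      congrFun (heig j) k
  let E : ℝ → Matrix (Fin N) (Fin N) ℂ := fun x => Matrix.diagonal fun i => Complex.exp (ζ i * x)
  let E' : ℝ → Matrix (Fin N) (Fin N) ℂ := fun x =>
    Matrix.diagonal fun i => Complex.exp (-(ζ i * x))
  have hEE' : ∀ x, E x * E' x = 1 := fun x => by
    simp [E, E', Matrix.diagonal_mul_diagonal, ← Complex.exp_add]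
  have hU₀E : ∀ x, U₀ x = P * E x := fun x => by
    ext k j
    simp [hU₀, E, hPdef, Matrix.mul_diagonal, mul_comm]
  have hU₀inv : ∀ x, (U₀ x)⁻¹ = E' x * P⁻¹ := fun x => by
    refine Matrix.inv_eq_right_inv ?_
    rw [hU₀E, Matrix.mul_assoc, ← Matrix.mul_assoc (E x), hEE', Matrix.one_mul,
      Matrix.mul_nonsing_inv _ hPdet]
  have hU₀mul : ∀ x, U₀ x * (U₀ x)⁻¹ = 1 := fun x => by
    rw [hU₀inv, hU₀E, Matrix.mul_assoc, ← Matrix.mul_assoc (E x), hEE', Matrix.one_mul,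
      Matrix.mul_nonsing_inv _ hPdet]
  have hU₀mul' : ∀ x, (U₀ x)⁻¹ * U₀ x = 1 := fun x => mul_eq_one_comm.1 (hU₀mul x)
  set C : Matrix (Fin N) (Fin N) ℂ := (U₀ x₀)⁻¹ * U x₀ with hC
  have hconst : ∀ x ∈ s, (U₀ x)⁻¹ * U x = C := by
    intro x hx
    have hentry : ∀ t i j, ((U₀ t)⁻¹ * U t) i j =
        Complex.exp (-(ζ i * t)) * (P⁻¹.mulVec (u j t)) i := fun t i j => by
      rw [hU₀inv, Matrix.mul_assoc, Matrix.diagonal_mul, hU]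
      rfl
    ext i j
    rw [hC, hentry, hentry]
    exact exp_mul_eigencoord_eq hP hLP hs hs' (fun t ht => (husol j).hasDerivAt hs hs' hV ht)
      i hx hx₀
  have hUC : ∀ x ∈ s, U x = U₀ x * C := fun x hx => by
    rw [← hconst x hx, ← Matrix.mul_assoc, hU₀mul, Matrix.one_mul]
  have hCdet : IsUnit C.det := by
    refine isUnit_iff_ne_zero.2 fun h => hdet x₀ ?_
    rw [hUC x₀ hx₀, Matrix.det_mul, h, mul_zero]
  have hCcol : ∀ i ∉ T, ∀ k, C k i = (1 : Matrix (Fin N) (Fin N) ℂ) k i := fun i hi k => by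
    rw [← hU₀mul' x₀, hC, Matrix.mul_apply, Matrix.mul_apply]
    refine Finset.sum_congr rfl fun m _ => ?_
    rw [hU, hU₀]
    simp [hbc i hi x₀ hx₀]
  have hCinv : ∀ i ∉ T, ∀ k, (C⁻¹ - 1) k i = 0 := fun i hi k => by
    have hmul : (C⁻¹ * C) k i = C⁻¹ k i := by
      rw [Matrix.mul_apply, Finset.sum_congr rfl fun m _ => by rw [hCcol i hi m],
        ← Matrix.mul_apply, Matrix.mul_one]
    rw [Matrix.sub_apply, ← hmul, Matrix.nonsing_inv_mul _ hCdet, sub_self]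
  have hformula : ∀ x ∈ s, (U x)⁻¹ j l - (U₀ x)⁻¹ j l =
      ∑ i, (C⁻¹ - 1) j i * (Complex.exp (-(ζ i * x)) * P⁻¹ i l) := fun x hx => by
    have : (U x)⁻¹ - (U₀ x)⁻¹ = (C⁻¹ - 1) * (E' x * P⁻¹) := by
      rw [hUC x hx, Matrix.mul_inv_rev, Matrix.sub_mul, Matrix.one_mul, hU₀inv]
    rw [← Matrix.sub_apply, this, Matrix.mul_apply]
    simp only [E', Matrix.diagonal_mul]
  have hsum : (fun x : ℝ =>
      ∑ i, (C⁻¹ - 1) j i * (Complex.exp (-(ζ i * x)) * P⁻¹ i l)) =O[F] f := by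
    refine IsBigO.fun_sum fun i _ => ?_
    by_cases hi : i ∈ T
    · have hexp : (fun x : ℝ => Complex.exp (-(ζ i * x))) =O[F] f := by
        refine IsBigO.of_norm_left ((hf i hi).congr_left fun x => ?_)
        simp [Complex.norm_exp]
      refine (hexp.const_mul_left ((C⁻¹ - 1) j i * P⁻¹ i l)).congr_left fun x => ?_
      ring
    · simp only [hCinv i hi, zero_mul]
      exact isBigO_zero _ _
  refine hsum.congr' ?_ .rfl
  filter_upwards [hsF] with x hx
  exact (hformula x hx).symm

/-- with `G(x) = U(x)⁻¹` and `G⁰(x) = U₀(x)⁻¹` (the free fundamental matrix having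
columns `p_j e^{ζ_j x}`), for every `l`:
`g_{j,l}(x) − g⁰_{j,l}(x) = O(e^{−ρ₊ x})` as `x → +∞` for `j = n+1,…,N`, and
`g_{j,l}(x) − g⁰_{j,l}(x) = O(e^{ρ₋ x})` as `x → −∞` for `j = 1,…,n`. -/
theorem statement_6 (N n : ℕ) (hN : 1 ≤ N) (hn : n ≤ N)
    (L₀ : Matrix (Fin N) (Fin N) ℂ) (ζ : Fin N → ℂ) (p : Fin N → Fin N → ℂ)
    (hdist : Function.Injective ζ)
    (heig : ∀ j, L₀.mulVec (p j) = ζ j • p j) (hp0 : ∀ j, p j ≠ 0)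
    (hre : ∀ j, (ζ j).re ≠ 0)
    (hpos : ∀ j : Fin N, (j : ℕ) < n → 0 < (ζ j).re)
    (hneg : ∀ j : Fin N, n ≤ (j : ℕ) → (ζ j).re < 0)
    (a : ℝ) (ha : 0 < a)
    (V : ℝ → Matrix (Fin N) (Fin N) ℂ)
    (hVloc : ∀ i j : Fin N, MeasureTheory.LocallyIntegrable fun x : ℝ => V x i j)
    (hVsupp : ∀ x : ℝ, x ∉ Set.Icc (-a) a → V x = 0)
    (u : Fin N → ℝ → Fin N → ℂ)
    (husol : ∀ j, IsSolV N (fun x => L₀ + V x) (u j))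
    (hbcm : ∀ j : Fin N, (j : ℕ) < n → ∀ x : ℝ, x < -a → u j x = Complex.exp (ζ j * x) • p j)
    (hbcp : ∀ j : Fin N, n ≤ (j : ℕ) → ∀ x : ℝ, x > a → u j x = Complex.exp (ζ j * x) • p j)
    (U : ℝ → Matrix (Fin N) (Fin N) ℂ)
    (hU : ∀ x, U x = Matrix.of fun k j => u j x k)
    (hdet : ∀ x, (U x).det ≠ 0)
    (U₀ : ℝ → Matrix (Fin N) (Fin N) ℂ)
    (hU₀ : ∀ x, U₀ x = Matrix.of fun k j => Complex.exp (ζ j * x) * p j k)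
    (ρp ρm : ℝ)
    (hρp : IsLeast ((fun j => (ζ j).re) '' {j : Fin N | (j : ℕ) < n}) ρp)
    (hρm : IsLeast ((fun j => |(ζ j).re|) '' {j : Fin N | n ≤ (j : ℕ)}) ρm) :
    ∀ l : Fin N,
      (∀ j : Fin N, n ≤ (j : ℕ) →
        (fun x : ℝ => (U x)⁻¹ j l - (U₀ x)⁻¹ j l) =O[atTop] fun x : ℝ => Real.exp (-ρp * x)) ∧
      (∀ j : Fin N, (j : ℕ) < n →
        (fun x : ℝ => (U x)⁻¹ j l - (U₀ x)⁻¹ j l) =O[atBot] fun x : ℝ => Real.exp (ρm * x)) := by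
  intro l
  constructor
  · intro j hj
    refine inv_sub_free_inv_isBigO (T := {i | (i : ℕ) < n}) hdist heig hp0 husol hU hdet hU₀
      (isOpen_Ioi (a := a)) Set.ordConnected_Ioi
      (fun x hx => hVsupp x fun h => absurd h.2 (not_le.2 hx)) (Ioi_mem_atTop a)
      (fun i hi => hbcp i (not_lt.1 hi)) (fun i hi => ?_) (not_lt.2 hj) l
    refine IsBigO.of_bound' ?_
    filter_upwards [eventually_ge_atTop 0] with x hx
    have hle : ρp ≤ (ζ i).re := hρp.2 ⟨i, hi, rfl⟩
    rw [Real.norm_of_nonneg (Real.exp_nonneg _), Real.norm_of_nonneg (Real.exp_nonneg _),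
      Real.exp_le_exp]
    nlinarith
  · intro j hj
    refine inv_sub_free_inv_isBigO (T := {i | n ≤ (i : ℕ)}) hdist heig hp0 husol hU hdet hU₀
      (isOpen_Iio (a := -a)) Set.ordConnected_Iio
      (fun x hx => hVsupp x fun h => absurd h.1 (not_le.2 hx)) (Iio_mem_atBot (-a))
      (fun i hi => hbcm i (not_le.1 hi)) (fun i hi => ?_) (not_le.2 hj) l
    refine IsBigO.of_bound' ?_
    filter_upwards [eventually_le_atBot 0] with x hx
    have hle : ρm ≤ -(ζ i).re := abs_of_neg (hneg i hi) ▸ hρm.2 ⟨i, hi, rfl⟩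
    rw [Real.norm_of_nonneg (Real.exp_nonneg _), Real.norm_of_nonneg (Real.exp_nonneg _),
      Real.exp_le_exp]
    nlinarith
end
end

section
/- Let Ω ⊆ ℂ be open, let L₀ : Ω → Matrix(N,N,ℂ) be differentiable, let V : ℝ → Matrix(N,N,ℂ) be continuous (independent of z), and let U : ℝ × Ω → Matrix(N,N,ℂ) be continuously differentiable in (x,z) with U(x,z) invertible for all (x,z) and ∂U/∂x (x,z) = (L₀(z) + V(x)) U(x,z). Then for all (x,z), ∂/∂x [ U(x,z)⁻¹ · ∂U/∂z (x,z) ] = U(x,z)⁻¹ · (dL₀/dz)(z) · U(x,z). -/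
open MeasureTheory Filter Topology

noncomputable section

/-- If `f` has continuous partial derivative `fx` in the real variable, which is itself
differentiable in the complex variable with jointly continuous derivative `g`, then the complex
partial derivative `fz` of `f` is differentiable in the real variable with derivative `g`. -/
theorem hasDerivAt_partial_of_continuousOn_mixed {Ω : Set ℂ} (hΩ : IsOpen Ω)
    {f fx fz g : ℝ → ℂ → ℂ}
    (hfx : ∀ x, ∀ z ∈ Ω, HasDerivAt (fun x' => f x' z) (fx x z) x)
    (hfz : ∀ x, ∀ z ∈ Ω, HasDerivAt (f x) (fz x z) z)
    (hg : ∀ x, ∀ z ∈ Ω, HasDerivAt (fx x) (g x z) z)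
    (hfxc : ContinuousOn (fun q : ℝ × ℂ => fx q.1 q.2) (Set.univ ×ˢ Ω))
    (hgc : ContinuousOn (fun q : ℝ × ℂ => g q.1 q.2) (Set.univ ×ˢ Ω))
    (x : ℝ) {z : ℂ} (hz : z ∈ Ω) :
    HasDerivAt (fun x' => fz x' z) (g x z) x := by
  have slice : ∀ {h : ℝ → ℂ → ℂ}, ContinuousOn (fun q : ℝ × ℂ => h q.1 q.2) (Set.univ ×ˢ Ω) →
      ∀ w ∈ Ω, Continuous fun s => h s w := by
    intro h hc w hw
    exact hc.comp_continuous (f := fun s : ℝ => (s, w)) (by fun_prop)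
      fun s => ⟨Set.mem_univ _, hw⟩
  obtain ⟨r, hr, hball⟩ := Metric.nhds_basis_closedBall.mem_iff.1 (hΩ.mem_nhds hz)
  have key : ∀ y, fz y z = fz x z + ∫ s in x..y, g s z := by
    intro y
    obtain ⟨C, hC⟩ := ((isCompact_uIcc (a := x) (b := y)).prod
      (isCompact_closedBall z r)).exists_bound_of_continuousOn
        (hgc.mono (Set.prod_mono (Set.subset_univ _) hball))
    have hint := (intervalIntegral.hasDerivAt_integral_of_dominated_loc_of_deriv_le
      (μ := volume) (F := fun w s => fx s w) (F' := fun w s => g s w) (a := x) (b := y)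
      (bound := fun _ => C) (Metric.closedBall_mem_nhds z hr)
      (by
        filter_upwards [hΩ.mem_nhds hz] with w hw
        exact (slice hfxc w hw).aestronglyMeasurable)
      ((slice hfxc z hz).intervalIntegrable _ _)
      (slice hgc z hz).aestronglyMeasurable
      (.of_forall fun s hs w hw => hC (s, w) ⟨Set.uIoc_subset_uIcc hs, hw⟩)
      intervalIntegrable_const
      (.of_forall fun s _ w hw => hg s w (hball hw))).2
    have hdiff : HasDerivAt (fun w => ∫ s in x..y, fx s w) (fz y z - fz x z) z := by
      refine ((hfz y z hz).sub (hfz x z hz)).congr_of_eventuallyEq ?_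
      filter_upwards [hΩ.mem_nhds hz] with w hw
      exact intervalIntegral.integral_eq_sub_of_hasDerivAt (fun s _ => hfx s w hw)
        ((slice hfxc w hw).intervalIntegrable _ _)
    rw [hint.unique hdiff]
    ring
  rw [funext key]
  exact ((slice hgc z hz).integral_hasStrictDerivAt x x).hasDerivAt.const_add _

/-- Entrywise product rule for matrix-valued functions. -/
theorem hasDerivAt_matrix_mul_apply {𝕜 : Type*} [NontriviallyNormedField 𝕜] [NormedAlgebra 𝕜 ℂ]
    {l m n : Type*} [Fintype m] {A : 𝕜 → Matrix l m ℂ} {B : 𝕜 → Matrix m n ℂ}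
    {A' : Matrix l m ℂ} {B' : Matrix m n ℂ} {t : 𝕜}
    (hA : ∀ i j, HasDerivAt (fun s => A s i j) (A' i j) t)
    (hB : ∀ i j, HasDerivAt (fun s => B s i j) (B' i j) t) (i : l) (j : n) :
    HasDerivAt (fun s => (A s * B s) i j) ((A' * B t + A t * B') i j) t := by
  simp only [Matrix.add_apply, Matrix.mul_apply, ← Finset.sum_add_distrib]
  exact HasDerivAt.fun_sum fun k _ => (hA i k).mul (hB k j)

/-- Entrywise derivative of the inverse of an invertible matrix-valued function. -/
theorem hasDerivAt_matrix_inv_apply {n : Type*} [Fintype n] [DecidableEq n]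
    {A : ℝ → Matrix n n ℂ} {A' : Matrix n n ℂ} {t : ℝ}
    (hA : ∀ i j, HasDerivAt (fun s => A s i j) (A' i j) t)
    (hdet : (A t).det ≠ 0) (i j : n) :
    HasDerivAt (fun s => (A s)⁻¹ i j) ((-((A t)⁻¹ * A' * (A t)⁻¹)) i j) t := by
  let _ : NormedRing (Matrix n n ℂ) := Matrix.linftyOpNormedRing
  let _ : NormedAlgebra ℝ (Matrix n n ℂ) := Matrix.linftyOpNormedAlgebra
  have hA' : HasDerivAt A A' t := hasDerivAt_pi.2 fun i => hasDerivAt_pi.2 fun j => hA i j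
  have hunit : IsUnit (A t) := (Matrix.isUnit_iff_isUnit_det (A t)).2 hdet.isUnit
  obtain ⟨u, hu⟩ := hunit
  have hf := hasFDerivAt_ringInverse (𝕜 := ℝ) u
  rw [hu] at hf
  have hinv := hf.comp_hasDerivAt t hA'
  have huinv : (↑u⁻¹ : Matrix n n ℂ) = (A t)⁻¹ := by rw [← hu, Matrix.coe_units_inv]
  have hentry := hasDerivAt_pi.1 (hasDerivAt_pi.1 hinv i) j
  simpa [Function.comp_def, huinv, ← Matrix.nonsing_inv_eq_ringInverse] using hentry

/-- for a `z`-dependent family of fundamental matrices `U(x,z)` of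
`U' = (L₀(z) + V(x))U` (the coefficient `V` being independent of `z`), one has, entrywise,
`∂/∂x [U(x,z)⁻¹ ∂_z U(x,z)] = U(x,z)⁻¹ L₀'(z) U(x,z)`.
Continuous differentiability of `U` in `(x,z)` is encoded by the existence of partial
derivatives `Ux` (real) and `Uz` (complex), continuous on `ℝ × Ω` together with `U`. -/
theorem statement_10 (N : ℕ) (hN : 1 ≤ N) (Ω : Set ℂ) (hΩ : IsOpen Ω)
    (L₀ L₀' : ℂ → Matrix (Fin N) (Fin N) ℂ)
    (hL₀ : ∀ z ∈ Ω, ∀ i j : Fin N, HasDerivAt (fun z' => L₀ z' i j) (L₀' z i j) z)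
    (V : ℝ → Matrix (Fin N) (Fin N) ℂ) (hV : Continuous V)
    (U Ux Uz : ℝ → ℂ → Matrix (Fin N) (Fin N) ℂ)
    (hUinv : ∀ x : ℝ, ∀ z ∈ Ω, (U x z).det ≠ 0)
    (hUx : ∀ x : ℝ, ∀ z ∈ Ω, ∀ i j : Fin N,
      HasDerivAt (fun x' : ℝ => U x' z i j) (Ux x z i j) x)
    (hUz : ∀ x : ℝ, ∀ z ∈ Ω, ∀ i j : Fin N,
      HasDerivAt (fun z' : ℂ => U x z' i j) (Uz x z i j) z)
    (hODE : ∀ x : ℝ, ∀ z ∈ Ω, Ux x z = (L₀ z + V x) * U x z)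
    (hUc : ∀ i j : Fin N, ContinuousOn (fun q : ℝ × ℂ => U q.1 q.2 i j) (Set.univ ×ˢ Ω))
    (hUxc : ∀ i j : Fin N, ContinuousOn (fun q : ℝ × ℂ => Ux q.1 q.2 i j) (Set.univ ×ˢ Ω))
    (hUzc : ∀ i j : Fin N, ContinuousOn (fun q : ℝ × ℂ => Uz q.1 q.2 i j) (Set.univ ×ˢ Ω)) :
    ∀ x : ℝ, ∀ z ∈ Ω, ∀ i j : Fin N,
      HasDerivAt (fun x' : ℝ => ((U x' z)⁻¹ * Uz x' z) i j)
        (((U x z)⁻¹ * L₀' z * U x z) i j) x := by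
  intro x z hz
  have hL₀'c : ∀ i j, ContinuousOn (fun w => L₀' w i j) Ω := fun i j =>
    ((DifferentiableOn.deriv (fun w hw => (hL₀ w hw i j).differentiableAt.differentiableWithinAt)
      hΩ).continuousOn).congr fun w hw => (hL₀ w hw i j).deriv.symm
  have hL₀c : ∀ i j, ContinuousOn (fun w => L₀ w i j) Ω := fun i j w hw =>
    (hL₀ w hw i j).continuousAt.continuousWithinAt
  have hsnd : Set.MapsTo (Prod.snd : ℝ × ℂ → ℂ) (Set.univ ×ˢ Ω) Ω := fun _ hq => hq.2
  have hUzx : ∀ i j, HasDerivAt (fun x' => Uz x' z i j)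
      ((L₀' z * U x z + (L₀ z + V x) * Uz x z) i j) x := by
    intro i j
    refine hasDerivAt_partial_of_continuousOn_mixed (f := fun s w => U s w i j)
      (fx := fun s w => Ux s w i j) (fz := fun s w => Uz s w i j)
      (g := fun s w => (L₀' w * U s w + (L₀ w + V s) * Uz s w) i j) hΩ
      (fun s w hw => hUx s w hw i j) (fun s w hw => hUz s w hw i j) ?_ (hUxc i j) ?_ x hz
    · intro s w hw
      refine (hasDerivAt_matrix_mul_apply (A := fun w => L₀ w + V s)
        (fun a b => (hL₀ w hw a b).add_const (V s a b)) (hUz s w hw) i j).congr_of_eventuallyEq ?_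
      filter_upwards [hΩ.mem_nhds hw] with w' hw'
      rw [hODE s w' hw']
    · simp only [Matrix.add_apply, Matrix.mul_apply]
      refine .add (continuousOn_finsetSum _ fun k _ => ?_)
        (continuousOn_finsetSum _ fun k _ => ?_)
      · exact ((hL₀'c i k).comp continuousOn_snd hsnd).mul (hUc k j)
      · exact (((hL₀c i k).comp continuousOn_snd hsnd).add
          ((hV.matrix_elem i k).comp continuous_fst).continuousOn).mul (hUzc k j)
  intro i j
  have hcancel : U x z * (U x z)⁻¹ = 1 := Matrix.mul_nonsing_inv _ (hUinv x z hz).isUnit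
  have hvalue : (U x z)⁻¹ * L₀' z * U x z = -((U x z)⁻¹ * Ux x z * (U x z)⁻¹) * Uz x z +
      (U x z)⁻¹ * (L₀' z * U x z + (L₀ z + V x) * Uz x z) := by
    rw [hODE x z hz, ← mul_assoc (U x z)⁻¹ (L₀ z + V x) (U x z), mul_assoc _ (U x z) _, hcancel]
    noncomm_ring
  rw [hvalue]
  exact hasDerivAt_matrix_mul_apply
    (hasDerivAt_matrix_inv_apply (hUx x z hz) (hUinv x z hz)) hUzx i j
end
end
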